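/- Let d11, d12, d21, d22, k1, k2 be real numbers satisfying d11 < 0, d22 < 0, d21 > 0, d11*d22 - d12*d21 ≤ 0, and k1*d21 - k2*d11 < 0. Then there do not exist real numbers α ≥ 0 and β ≥ 0 such that k1 ≥ α*d11 + β*d12 and k2 ≥ α*d21 + β*d22. -/

import Mathlib

/-- Numerical core of the uniruledness criterion (Proposition 5.1). -/
theorem stmt_0 (d11 d12 d21 d22 k1 k2 : ℝ)
    (h11 : d11 < 0) (h22 : d22 < 0) (h21 : d21 > 0)
    (hdet1 : d11 * d22 - d12 * d21 ≤ 0)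
    (hdet2 : k1 * d21 - k2 * d11 < 0) :
    ¬ ∃ α β : ℝ, 0 ≤ α ∧ 0 ≤ β ∧
      k1 ≥ α * d11 + β * d12 ∧ k2 ≥ α * d21 + β * d22 := by
  rintro ⟨α, β, -, hβ, hk1, hk2⟩
  have h1 := mul_le_mul_of_nonneg_right hk1 h21.le
  have h2 := mul_le_mul_of_nonpos_right hk2 h11.le
  have h3 := mul_nonpos_of_nonneg_of_nonpos hβ hdet1
  linarith
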